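/- Let M be a von Neumann algebra and x ∈ M with ‖x‖ ≤ 1. Then x is a C*-extreme point of the closed unit ball of M if and only if there exist central projections p₁, p₂, p₃ ∈ M with p₁ + p₂ + p₃ = 1 such that: p₁ = 0 or p₁x is a unitary in p₁M; p₂ = 0 or p₂x is a non-unitary isometry in p₂M; and p₃ = 0 or p₃x is a non-unitary coisometry in p₃M. -/

import Mathlib

/-- `x` is a C*-extreme point of the closed unit ball of the von Neumann algebra `M`. -/
def IsCStarExtremePoint {H : Type*} [NormedAddCommGroup H] [InnerProductSpace ℂ H]
    [CompleteSpace H] (M : VonNeumannAlgebra H) (x : H →L[ℂ] H) : Prop :=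
  x ∈ M ∧ ‖x‖ ≤ 1 ∧
    ∀ (k : ℕ) (a t : Fin k → (H →L[ℂ] H)),
      (∀ i, a i ∈ M) → (∀ i, ‖a i‖ ≤ 1) → (∀ i, t i ∈ M) →
      (∀ i, ∃ s ∈ M, t i * s = 1 ∧ s * t i = 1) →
      (∑ i, star (t i) * t i) = 1 → x = ∑ i, star (t i) * a i * t i →
      ∀ i, ∃ u ∈ M, star u * u = 1 ∧ u * star u = 1 ∧ a i = star u * x * u

/-- `p` is a central projection of the von Neumann algebra `M`. -/
def IsCentralProjection {H : Type*} [NormedAddCommGroup H] [InnerProductSpace ℂ H]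
    [CompleteSpace H] (M : VonNeumannAlgebra H) (p : H →L[ℂ] H) : Prop :=
  p ∈ M ∧ star p = p ∧ p * p = p ∧ ∀ a ∈ M, p * a = a * p

namespace VonNeumannAlgebra

variable {H : Type*} [NormedAddCommGroup H] [InnerProductSpace ℂ H] [CompleteSpace H]
  {M : VonNeumannAlgebra H}

theorem mem_iff_forall_commute {a : H →L[ℂ] H} :
    a ∈ M ↔ ∀ y ∈ M.commutant, Commute y a := by
  conv_lhs => rw [← commutant_commutant M, mem_commutant_iff]
  rfl

theorem commute_of_mem_commutant {a y : H →L[ℂ] H} (ha : a ∈ M) (hy : y ∈ M.commutant) :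
    Commute y a :=
  mem_iff_forall_commute.1 ha y hy

theorem smul_mem (c : ℂ) {a : H →L[ℂ] H} (ha : a ∈ M) : c • a ∈ M :=
  M.toStarSubalgebra.smul_mem ha c

theorem sqrt_mem {a : H →L[ℂ] H} (ha : a ∈ M) : CFC.sqrt a ∈ M :=
  mem_iff_forall_commute.2 fun _ hy =>
    ((commute_of_mem_commutant ha hy).symm.cfcₙ_nnreal NNReal.sqrt).symm

theorem abs_mem {a : H →L[ℂ] H} (ha : a ∈ M) : CFC.abs a ∈ M :=
  sqrt_mem (mul_mem (star_mem ha) ha)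

/-- An operator with a two-sided inverse in `B(H)` has it in `M`. -/
theorem mem_of_mul_eq_one {a b : H →L[ℂ] H} (ha : a ∈ M) (hab : a * b = 1) (hba : b * a = 1) :
    b ∈ M :=
  mem_iff_forall_commute.2 fun y hy => by
    have h := (commute_of_mem_commutant ha hy).eq
    calc y * b = b * a * (y * b) := by rw [hba, one_mul]
      _ = b * (a * y) * b := by noncomm_ring
      _ = b * y * (a * b) := by rw [← h]; noncomm_ring
      _ = b * y := by rw [hab, mul_one]

theorem norm_abs_apply (a : H →L[ℂ] H) (ξ : H) : ‖CFC.abs a ξ‖ = ‖a ξ‖ := by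
  have h : star (CFC.abs a) * CFC.abs a = star a * a := by
    rw [(CFC.abs_nonneg a).isSelfAdjoint.star_eq, CFC.abs_mul_abs]
  have h' : ‖CFC.abs a ξ‖ ^ 2 = ‖a ξ‖ ^ 2 := by
    rw [ContinuousLinearMap.apply_norm_sq_eq_inner_adjoint_left,
      ContinuousLinearMap.apply_norm_sq_eq_inner_adjoint_left]
    exact congrArg (fun b : H →L[ℂ] H => RCLike.re (inner ℂ (b ξ) ξ)) h
  exact (sq_eq_sq₀ (norm_nonneg _) (norm_nonneg _)).1 h'

/-- Polar decomposition in a von Neumann algebra. -/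
theorem exists_polar_decomposition {x : H →L[ℂ] H} (hx : x ∈ M) :
    ∃ v ∈ M, v * star v * v = v ∧ ‖v‖ ≤ 1 ∧ x = v * CFC.abs x := by
  set h := CFC.abs x with hdef
  let K : Submodule ℂ H := (LinearMap.range (h : H →ₗ[ℂ] H)).topologicalClosure
  have hK : ∀ ξ, h ξ ∈ K := fun ξ => Submodule.le_topologicalClosure _ ⟨ξ, rfl⟩
  have : CompleteSpace K := (Submodule.isClosed_topologicalClosure _).completeSpace_coe
  let e : H →ₗ[ℂ] K := (h : H →ₗ[ℂ] H).codRestrict K hK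
  have he : DenseRange e := by
    intro k
    rw [closure_subtype]
    have hk : (k : H) ∈ closure (Set.range h) := k.2
    convert! hk
    ext η
    simp [e]
  have hnorm : ∀ ξ, ‖(x : H →ₗ[ℂ] H) ξ‖ = ‖e ξ‖ := fun ξ => (norm_abs_apply x ξ).symm
  have hbd : ∀ ξ, ‖(x : H →ₗ[ℂ] H) ξ‖ ≤ 1 * ‖e ξ‖ := fun ξ => by rw [hnorm, one_mul]
  let V : K →L[ℂ] H := (x : H →ₗ[ℂ] H).extendOfNorm e
  have hVe : ∀ ξ, V (e ξ) = x ξ := LinearMap.extendOfNorm_eq he ⟨1, hbd⟩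
  have hV : ∀ k, ‖V k‖ = ‖k‖ := fun k =>
    he.induction (P := fun k => ‖V k‖ = ‖k‖)
      (by rintro _ ⟨ξ, rfl⟩; rw [hVe]; exact hnorm ξ)
      (isClosed_eq (by fun_prop) (by fun_prop)) k
  have hVV := (ContinuousLinearMap.norm_map_iff_adjoint_comp_self V).1 hV
  let v : H →L[ℂ] H := V ∘L K.orthogonalProjectionOnto
  have hv : ∀ ξ, ‖v ξ‖ ≤ ‖ξ‖ := fun ξ => (hV _).trans_le (K.norm_orthogonalProjectionOnto_apply_le ξ)
  have hvh : ∀ ξ, v (h ξ) = x ξ := fun ξ => by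
    have : K.orthogonalProjectionOnto (h ξ) = e ξ :=
      K.orthogonalProjectionOnto_mem_subspace_eq_self (e ξ)
    change V (K.orthogonalProjectionOnto (h ξ)) = x ξ
    rw [this, hVe]
  have hvP : v * K.starProjection = v := by
    ext ξ
    change V (K.orthogonalProjectionOnto (K.starProjection ξ)) = V (K.orthogonalProjectionOnto ξ)
    exact congrArg V (K.orthogonalProjectionOnto_mem_subspace_eq_self (K.orthogonalProjectionOnto ξ))
  have hPM : K.starProjection ∈ M := by
    rw [IsStarProjection.mem_iff isStarProjection_starProjection]
    intro y hy
    rw [Submodule.range_starProjection, Module.End.mem_invtSubmodule_iff_forall_mem_of_mem]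
    intro η hη
    have hη' : η ∈ closure (Set.range h) := hη
    have := map_mem_closure y.continuous hη' (t := Set.range h) (by
      rintro _ ⟨ξ, rfl⟩
      exact ⟨y ξ, (congrArg (· ξ) (commute_of_mem_commutant (abs_mem hx) hy).eq).symm⟩)
    exact this
  refine ⟨v, mem_iff_forall_commute.2 fun y hy => ?_, ?_, ?_, ?_⟩
  · have hPy := (commute_of_mem_commutant hPM hy).eq
    have hhy := (commute_of_mem_commutant (abs_mem hx) hy).eq
    have hxy := (commute_of_mem_commutant hx hy).eq
    have key : ∀ η ∈ K, y (v η) = v (y η) := by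
      intro η hη
      have hη' : η ∈ closure (Set.range h) := hη
      refine closure_minimal (s := Set.range h) (t := {η | y (v η) = v (y η)}) ?_
        (isClosed_eq (by fun_prop) (by fun_prop)) hη'
      rintro _ ⟨ξ, rfl⟩
      have h1 : y (h ξ) = h (y ξ) := congrArg (· ξ) hhy
      have h2 : y (x ξ) = x (y ξ) := congrArg (· ξ) hxy
      simp only [Set.mem_ofPred_eq]
      rw [hvh, h1, hvh, h2]
    change y * v = v * y
    rw [← hvP, mul_assoc v, ← hPy, ← mul_assoc, ← mul_assoc]
    ext η
    exact key _ (K.starProjection_apply_mem η)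
  · have h1 : star v * v = K.starProjection := by
      change ContinuousLinearMap.adjoint (V ∘L K.orthogonalProjectionOnto) ∘L
        (V ∘L K.orthogonalProjectionOnto) = _
      rw [ContinuousLinearMap.adjoint_comp, ContinuousLinearMap.comp_assoc,
        ← ContinuousLinearMap.comp_assoc V.adjoint, hVV, Submodule.adjoint_orthogonalProjectionOnto]
      rfl
    rw [mul_assoc, h1, hvP]
  · exact ContinuousLinearMap.opNorm_le_bound _ zero_le_one fun ξ => by simpa using hv ξ
  · ext ξ
    exact (hvh ξ).symm

end VonNeumannAlgebra

section Extreme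

variable {H : Type*} [NormedAddCommGroup H] [InnerProductSpace ℂ H] [CompleteSpace H]
  {M : VonNeumannAlgebra H}

open VonNeumannAlgebra

theorem IsCentralProjection.one_sub {z : H →L[ℂ] H} (hz : IsCentralProjection M z) :
    IsCentralProjection M (1 - z) := by
  obtain ⟨hM, hs, hi, hc⟩ := hz
  refine ⟨sub_mem (one_mem M) hM, by simp [hs], ?_, fun a ha => ?_⟩
  · calc _ = 1 - z - z + z * z := by noncomm_ring
      _ = _ := by rw [hi]; abel
  · rw [sub_mul, mul_sub, hc a ha, one_mul, mul_one]

/-- The components of a midpoint decomposition of a C*-extreme point are unitarily equivalent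
to it. -/
theorem IsCStarExtremePoint.exists_unitary_of_midpoint {x a b : H →L[ℂ] H}
    (hx : IsCStarExtremePoint M x) (ha : a ∈ M) (hb : b ∈ M) (ha1 : ‖a‖ ≤ 1) (hb1 : ‖b‖ ≤ 1)
    (hab : x = (2⁻¹ : ℂ) • (a + b)) :
    ∃ u ∈ M, star u * u = 1 ∧ u * star u = 1 ∧ a = star u * x * u := by
  obtain ⟨-, -, h⟩ := hx
  let c : ℂ := ((√2)⁻¹ : ℝ)
  have hcc : c * c = 2⁻¹ := by
    simp only [c, ← Complex.ofReal_mul, ← mul_inv]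
    rw [Real.mul_self_sqrt (by norm_num)]
    norm_num
  have hc0 : c ≠ 0 := by
    intro h0
    rw [h0] at hcc
    norm_num at hcc
  have hcs : star c = c := Complex.conj_ofReal _
  have key := h 2 ![a, b] (fun _ => c • 1) (by simp [Fin.forall_fin_two, ha, hb])
    (by simp [Fin.forall_fin_two, ha1, hb1]) (fun _ => smul_mem c (one_mem M))
    (fun _ => ⟨c⁻¹ • 1, smul_mem _ (one_mem M), by simp [smul_smul, hc0], by simp [smul_smul, hc0]⟩)
    (by
      simp only [star_smul, star_one, hcs, Fin.sum_univ_two, smul_mul_smul_comm, hcc, mul_one,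
        ← add_smul]
      norm_num)
    (by
      simp only [star_smul, star_one, hcs, Fin.sum_univ_two, smul_mul_assoc, mul_smul_comm,
        one_mul, mul_one, smul_smul, hcc]
      simp [hab])
  exact key 0

theorem mul_star_idempotent_of_unitary_conj {x a u : H →L[ℂ] H} (hu : star u * u = 1)
    (hu' : u * star u = 1) (h : a = star u * x * u) (ha : IsIdempotentElem (a * star a)) :
    IsIdempotentElem (x * star x) := by
  have hx : x = u * a * star u := by
    rw [h]
    calc x = (u * star u) * x * (u * star u) := by rw [hu', one_mul, mul_one]
      _ = _ := by noncomm_ring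
  have hxx : x * star x = u * (a * star a) * star u := by
    rw [hx]
    simp only [star_mul, star_star]
    calc _ = u * a * (star u * u) * star a * star u := by noncomm_ring
      _ = _ := by rw [hu]; noncomm_ring
  rw [hxx]
  have ha' : a * star a * (a * star a) = a * star a := ha
  calc _ = u * (a * star a) * (star u * u) * (a * star a) * star u := by noncomm_ring
    _ = u * (a * star a * (a * star a)) * star u := by rw [hu]; noncomm_ring
    _ = _ := by rw [ha']

/-- A C*-extreme point is a partial isometry. -/
theorem IsCStarExtremePoint.isIdempotentElem_mul_star {x : H →L[ℂ] H}
    (hx : IsCStarExtremePoint M x) : IsIdempotentElem (x * star x) := by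
  have hxM := hx.1
  obtain ⟨v, hv, hvv, hv1, hxv⟩ := exists_polar_decomposition hxM
  set h := CFC.abs x
  have hh : IsSelfAdjoint h := (CFC.abs_nonneg x).isSelfAdjoint
  have hh1 : ‖h‖ ≤ 1 := by rw [CFC.norm_abs]; exact hx.2.1
  have hw := hh.self_add_I_smul_cfcSqrt_sub_sq_mem_unitary h hh1
  set s := CFC.sqrt (1 - h ^ 2)
  have hs : star s = s := (CFC.sqrt_nonneg (1 - h ^ 2)).isSelfAdjoint.star_eq
  have hhM : h ∈ M := abs_mem hxM
  have hsM : s ∈ M := sqrt_mem (sub_mem (one_mem M) (pow_mem hhM 2))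
  set w := h + Complex.I • s with hwdef
  have hwM : w ∈ M := add_mem hhM (smul_mem _ hsM)
  have hsw : star w = h - Complex.I • s := by
    simp [hwdef, hh.star_eq, hs, sub_eq_add_neg]
  have hbound : ∀ u ∈ unitary (H →L[ℂ] H), ‖v * u‖ ≤ 1 := fun u hu =>
    (norm_mul_le _ _).trans (mul_le_one₀ hv1 (norm_nonneg _)
      (ContinuousLinearMap.opNorm_le_bound _ zero_le_one fun ξ => by
        rw [ContinuousLinearMap.norm_map_of_mem_unitary hu, one_mul]))
  obtain ⟨u, -, hu, hu', hau⟩ := hx.exists_unitary_of_midpoint (mul_mem hv hwM)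
    (mul_mem hv (star_mem hwM)) (hbound w hw) (hbound _ (Unitary.star_mem hw)) (by
      rw [← mul_add, hsw, hwdef, add_add_sub_cancel, ← two_smul ℂ h, mul_smul_comm, smul_smul, ← hxv]
      norm_num)
  refine mul_star_idempotent_of_unitary_conj hu hu' hau ?_
  have : v * w * star (v * w) = v * star v := by
    calc _ = v * (w * star w) * star v := by rw [star_mul]; noncomm_ring
      _ = _ := by rw [Unitary.mul_star_self_of_mem hw, mul_one]
  rw [this]
  change v * star v * (v * star v) = v * star v
  rw [← mul_assoc, hvv]

theorem mul_star_mul_self_of_isIdempotentElem {x : H →L[ℂ] H}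
    (h : IsIdempotentElem (x * star x)) : x * star x * x = x := by
  have h' : x * star x * (x * star x) = x * star x := h
  have : (x * star x * x - x) * star (x * star x * x - x) = 0 := by
    simp only [star_sub, star_mul, star_star]
    calc _ = x * star x * (x * star x) * (x * star x) - x * star x * (x * star x)
          - x * star x * (x * star x) + x * star x := by noncomm_ring
      _ = 0 := by rw [h', h']; abel
  exact sub_eq_zero.1 ((CStarRing.mul_star_self_eq_zero_iff _).1 this)

/-- The two defect projections of a C*-extreme point are centrally orthogonal. -/
theorem IsCStarExtremePoint.defect_mul_mul_defect_eq_zero {x m : H →L[ℂ] H}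
    (hx : IsCStarExtremePoint M x) (hm : m ∈ M) :
    (1 - x * star x) * m * (1 - star x * x) = 0 := by
  have hxM := hx.1
  have hxx : x * star x * x = x :=
    mul_star_mul_self_of_isIdempotentElem hx.isIdempotentElem_mul_star
  have hxx' : star x * x * star x = star x := by
    simpa [mul_assoc] using congrArg star hxx
  by_contra hne
  set d := (1 - x * star x) * m * (1 - star x * x) with hd
  have hdM : d ∈ M := mul_mem (mul_mem (sub_mem (one_mem M) (mul_mem hxM (star_mem hxM))) hm)
    (sub_mem (one_mem M) (mul_mem (star_mem hxM) hxM))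
  have hxd : star x * d = 0 := by
    calc _ = (star x - star x * x * star x) * m * (1 - star x * x) := by rw [hd]; noncomm_ring
      _ = 0 := by rw [hxx']; simp
  have hdx : d * star x = 0 := by
    calc _ = (1 - x * star x) * m * (star x - star x * x * star x) := by rw [hd]; noncomm_ring
      _ = 0 := by rw [hxx']; simp
  let r : ℂ := ((2 * ‖d‖)⁻¹ : ℝ)
  set c := r • d with hc
  have hcn : ‖c‖ = 1 / 2 := by
    have : ‖d‖ ≠ 0 := norm_ne_zero_iff.2 hne
    rw [hc, norm_smul, Complex.norm_real, Real.norm_of_nonneg (by positivity)]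
    field_simp
  have hcM : c ∈ M := smul_mem _ hdM
  have hxc : star x * c = 0 := by rw [hc, mul_smul_comm, hxd, smul_zero]
  have hcx : c * star x = 0 := by rw [hc, smul_mul_assoc, hdx, smul_zero]
  have hcx' : star c * x = 0 := by simpa using congrArg star hxc
  have hxc' : x * star c = 0 := by simpa using congrArg star hcx
  have hsum : (x + c) * star (x + c) = x * star x + c * star c := by
    rw [star_add, mul_add, add_mul, add_mul, hcx, hxc']; abel
  have hdiff : (x - c) * star (x - c) = x * star x + c * star c := by
    rw [star_sub, mul_sub, sub_mul, sub_mul, hcx, hxc']; abel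
  have hle : x * star x + c * star c ≤ 1 := by
    have hfc : (1 - x * star x) * c = c := by
      rw [sub_mul, one_mul, mul_assoc, hxc, mul_zero, sub_zero]
    have hsf : star (1 - x * star x) = 1 - x * star x := by simp
    have hff : (1 - x * star x) * (1 - x * star x) = 1 - x * star x := by
      calc _ = 1 - x * star x - x * star x + x * star x * x * star x := by noncomm_ring
        _ = _ := by rw [hxx]; abel
    have hcc : c * star c ≤ 1 := by
      rw [← CStarAlgebra.norm_le_one_iff_of_nonneg _ (mul_star_self_nonneg c),
        CStarRing.norm_self_mul_star, hcn]
      norm_num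
    have h1 := star_right_conjugate_le_conjugate hcc (1 - x * star x)
    rw [mul_one, hsf, hff] at h1
    have h2 : (1 - x * star x) * (c * star c) * (1 - x * star x) = c * star c := by
      calc _ = ((1 - x * star x) * c) * star ((1 - x * star x) * c) := by
            rw [star_mul, hsf]; noncomm_ring
        _ = _ := by rw [hfc]
    rw [h2] at h1
    calc x * star x + c * star c ≤ x * star x + (1 - x * star x) := by gcongr
      _ = 1 := by abel
  have hnonneg : 0 ≤ x * star x + c * star c :=
    add_nonneg (mul_star_self_nonneg x) (mul_star_self_nonneg c)
  have hnorm : ∀ y : H →L[ℂ] H, y * star y = x * star x + c * star c → ‖y‖ ≤ 1 := by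
    intro y hy
    have : ‖y‖ * ‖y‖ ≤ 1 := by
      rw [← CStarRing.norm_self_mul_star, hy,
        CStarAlgebra.norm_le_one_iff_of_nonneg _ hnonneg]
      exact hle
    nlinarith [norm_nonneg y]
  obtain ⟨u, -, hu, hu', hau⟩ := hx.exists_unitary_of_midpoint (add_mem hxM hcM)
    (sub_mem hxM hcM) (hnorm _ hsum) (hnorm _ hdiff) (by
      rw [add_add_sub_cancel, ← two_smul ℂ x, smul_smul]
      norm_num)
  have hidem : IsIdempotentElem ((x + c) * star (x + c)) := by
    refine mul_star_idempotent_of_unitary_conj (a := x) (u := star u) (by rwa [star_star])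
      (by rwa [star_star]) ?_ hx.isIdempotentElem_mul_star
    rw [hau, star_star]
    calc x = (u * star u) * x * (u * star u) := by rw [hu', one_mul, mul_one]
      _ = _ := by noncomm_ring
  rw [hsum] at hidem
  have hcc : c * star c * (c * star c) = c * star c := by
    have h1 : (x * star x + c * star c) * (x * star x + c * star c)
        = x * star x + c * star c := hidem
    have h2 : (x * star x + c * star c) * (x * star x + c * star c)
        = x * star x * x * star x + x * (star x * c) * star c + c * (star c * x) * star x
          + c * star c * (c * star c) := by noncomm_ring
    rw [h2, hxx, hxc, hcx'] at h1
    simpa using h1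
  have h1 := congrArg norm hcc
  rw [(IsSelfAdjoint.mul_star_self c).norm_mul_self, CStarRing.norm_self_mul_star, hcn] at h1
  norm_num at h1

/-- Two centrally orthogonal elements of `M` are separated by a central projection. -/
theorem VonNeumannAlgebra.exists_isCentralProjection_of_mul_mul_eq_zero {f e : H →L[ℂ] H}
    (hf : f ∈ M) (h : ∀ m ∈ M, f * m * e = 0) :
    ∃ z, IsCentralProjection M z ∧ f * z = 0 ∧ z * e = e := by
  let K : Submodule ℂ H := ⨅ m : M, LinearMap.ker ((f * (m : H →L[ℂ] H) : H →L[ℂ] H) : H →ₗ[ℂ] H)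
  have hK : ∀ ξ, ξ ∈ K ↔ ∀ m ∈ M, f (m ξ) = 0 := by
    intro ξ
    simp [K, Submodule.mem_iInf]
  have hclosed : IsClosed (K : Set H) := by
    simp only [K, Submodule.coe_iInf]
    exact isClosed_iInter fun m => (f * (m : H →L[ℂ] H)).isClosed_ker
  have : CompleteSpace K := hclosed.completeSpace_coe
  have hP := isStarProjection_starProjection (U := K)
  have hzM : K.starProjection ∈ M := by
    rw [IsStarProjection.mem_iff hP]
    intro y hy
    rw [Submodule.range_starProjection, Module.End.mem_invtSubmodule_iff_forall_mem_of_mem]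
    intro ξ hξ
    refine (hK _).2 fun m hm => ?_
    have h1 : y (f (m ξ)) = f (m (y ξ)) :=
      congrArg (· ξ) (commute_of_mem_commutant (mul_mem hf hm) hy).eq
    change f (m (y ξ)) = 0
    rw [← h1, (hK ξ).1 hξ m hm, map_zero]
  have hzM' : K.starProjection ∈ M.commutant := by
    rw [IsStarProjection.mem_iff hP, commutant_commutant]
    intro y hy
    rw [Submodule.range_starProjection, Module.End.mem_invtSubmodule_iff_forall_mem_of_mem]
    intro ξ hξ
    exact (hK _).2 fun m hm => (hK ξ).1 hξ (m * y) (mul_mem hm hy)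
  refine ⟨K.starProjection, ⟨hzM, hP.isSelfAdjoint.star_eq, hP.isIdempotentElem,
    fun a ha => (commute_of_mem_commutant ha hzM').eq⟩, ?_, ?_⟩
  · ext ξ
    exact (hK _).1 (K.starProjection_apply_mem ξ) 1 (one_mem M)
  · ext ξ
    refine K.starProjection_eq_self_iff.2 ((hK _).2 fun m hm => ?_)
    exact congrArg (· ξ) (h m hm)

/-- A C*-extreme point is the direct sum of an isometry and a coisometry. -/
theorem IsCStarExtremePoint.exists_isCentralProjection {x : H →L[ℂ] H}
    (hx : IsCStarExtremePoint M x) :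
    ∃ z, IsCentralProjection M z ∧ z * (star x * x) = z ∧
      (1 - z) * (x * star x) = 1 - z := by
  have hxM := hx.1
  obtain ⟨z, hz, hfz, hze⟩ := exists_isCentralProjection_of_mul_mul_eq_zero
    (sub_mem (one_mem M) (mul_mem hxM (star_mem hxM)))
    fun m hm => hx.defect_mul_mul_defect_eq_zero hm
  refine ⟨1 - z, hz.one_sub, ?_, ?_⟩
  · rw [mul_sub, mul_one] at hze
    rw [sub_mul, one_mul, ← sub_eq_zero, ← sub_eq_zero.2 hze]
    abel
  · rw [sub_sub_cancel]
    rw [← hz.2.2.2 _ (sub_mem (one_mem M) (mul_mem hxM (star_mem hxM))), mul_sub, mul_one,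
      sub_eq_zero] at hfz
    exact hfz.symm

end Extreme

theorem intertwine_inverse {R : Type*} [Ring R] {a x t s : R} (hat : a * t = t * x)
    (hst : s * t = 1) (hts : t * s = 1) : x * s = s * a := by
  calc x * s = s * t * x * s := by rw [hst, one_mul]
    _ = s * (t * x) * s := by noncomm_ring
    _ = s * a * (t * s) := by rw [← hat]; noncomm_ring
    _ = _ := by rw [hts, mul_one]

open Filter Topology in
theorem mul_eq_one_of_tendsto {H : Type*} [NormedAddCommGroup H]
    [InnerProductSpace ℂ H] {F G : ℕ → (H →L[ℂ] H)} {D E : H →L[ℂ] H} {C : ℝ}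
    (hFG : ∀ n, F n * G n = 1) (hC : ∀ n ξ, ‖F n ξ‖ ≤ C * ‖ξ‖)
    (hF : ∀ ξ, Tendsto (fun n => F n ξ) atTop (𝓝 (D ξ)))
    (hG : ∀ ξ, Tendsto (fun n => G n ξ) atTop (𝓝 (E ξ))) : D * E = 1 := by
  ext ξ
  refine tendsto_nhds_unique (hF (E ξ)) ?_
  rw [tendsto_iff_norm_sub_tendsto_zero]
  have h := ((tendsto_iff_norm_sub_tendsto_zero.1 (hG ξ)).const_mul C)
  rw [mul_zero] at h
  refine squeeze_zero (fun _ => norm_nonneg _) (fun n => ?_) h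
  have h1 : F n (G n ξ) = ξ := congrArg (· ξ) (hFG n)
  have h2 : F n (E ξ) - (1 : H →L[ℂ] H) ξ = F n (E ξ - G n ξ) := by rw [map_sub, h1]; rfl
  rw [h2, norm_sub_rev (G n ξ)]
  exact hC n _

section Isometry

variable {H : Type*} [NormedAddCommGroup H] [InnerProductSpace ℂ H] [CompleteSpace H]

theorem norm_apply_of_star_mul_self {x : H →L[ℂ] H} (hx : star x * x = 1) (ξ : H) :
    ‖x ξ‖ = ‖ξ‖ :=
  x.norm_map_iff_adjoint_comp_self.2 hx ξ

theorem inner_star_apply_right (x : H →L[ℂ] H) (ξ η : H) :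
    inner ℂ ξ (star x η) = inner ℂ (x ξ) η :=
  ContinuousLinearMap.adjoint_inner_right x ξ η

theorem star_mul_self_of_norm_apply {x : H →L[ℂ] H} (hx : ∀ ξ, ‖x ξ‖ = ‖ξ‖) : star x * x = 1 :=
  x.norm_map_iff_adjoint_comp_self.1 hx

/-- In a C*-convex decomposition of an isometry, each coefficient intertwines the isometry with
the corresponding component, which is isometric on the range of the coefficient. -/
theorem intertwine_of_cstarConvex_isometry {k : ℕ} {x : H →L[ℂ] H} {a t : Fin k → (H →L[ℂ] H)}
    (hx : star x * x = 1) (ha : ∀ i, ‖a i‖ ≤ 1) (ht : ∑ i, star (t i) * t i = 1)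
    (hxa : x = ∑ i, star (t i) * a i * t i) (i : Fin k) (ξ : H) :
    a i (t i ξ) = t i (x ξ) ∧ ‖a i (t i ξ)‖ = ‖t i ξ‖ := by
  have hsq : ∀ η, ∑ i, ‖t i η‖ ^ 2 = ‖η‖ ^ 2 := by
    intro η
    have h1 : (∑ i, star (t i) * t i : H →L[ℂ] H) η = η := by rw [ht]; rfl
    rw [← inner_self_eq_norm_sq (𝕜 := ℂ) η]
    conv_rhs => rw [← h1]
    nth_rewrite 1 [h1]
    simp [inner_sum, inner_star_apply_right, -inner_self_eq_norm_sq_to_K, inner_self_eq_norm_sq]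
  have hcross : ∑ i, RCLike.re (inner ℂ (a i (t i ξ)) (t i (x ξ))) = ‖x ξ‖ ^ 2 := by
    have h1 : (∑ i, star (t i) * a i * t i : H →L[ℂ] H) ξ = x ξ := by rw [← hxa]
    rw [← inner_self_eq_norm_sq (𝕜 := ℂ) (x ξ)]
    conv_rhs => rw [← h1]
    nth_rewrite 1 [h1]
    simp [inner_sum, inner_star_apply_right]
    exact Finset.sum_congr rfl fun j _ => inner_re_symm (𝕜 := ℂ) _ _
  have hle : ∀ j, ‖a j (t j ξ)‖ ^ 2 ≤ ‖t j ξ‖ ^ 2 := fun j => by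
    gcongr
    simpa using (a j).le_of_opNorm_le (ha j) (t j ξ)
  have hsum : ∑ j, (‖a j (t j ξ) - t j (x ξ)‖ ^ 2 + (‖t j ξ‖ ^ 2 - ‖a j (t j ξ)‖ ^ 2)) = 0 := by
    simp only [norm_sub_sq (𝕜 := ℂ), Finset.sum_add_distrib, Finset.sum_sub_distrib, hsq,
      ← Finset.mul_sum, hcross, norm_apply_of_star_mul_self hx]
    ring
  rw [Finset.sum_eq_zero_iff_of_nonneg fun j _ =>
    add_nonneg (sq_nonneg _) (sub_nonneg.2 (hle j))] at hsum
  have h := hsum i (Finset.mem_univ i)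
  have h1 := sq_nonneg ‖a i (t i ξ) - t i (x ξ)‖
  have h2 := hle i
  constructor
  · have : ‖a i (t i ξ) - t i (x ξ)‖ ^ 2 = 0 := by linarith
    exact sub_eq_zero.1 (norm_eq_zero.1 (pow_eq_zero_iff two_ne_zero |>.1 this))
  · exact (sq_eq_sq₀ (norm_nonneg _) (norm_nonneg _)).1 (by linarith)

theorem inner_defect_apply_eq_zero {x : H →L[ℂ] H} (hx : star x * x = 1) (ξ η : H) :
    inner ℂ ((1 - x * star x) ξ) (x η) = 0 := by
  have h : star x * (1 - x * star x) = 0 := by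
    rw [mul_sub, mul_one, ← mul_assoc, hx, one_mul, sub_self]
  have h' : star x ((1 - x * star x) ξ) = 0 := congrArg (· ξ) h
  have h1 := inner_star_apply_right (star x) ((1 - x * star x) ξ) η
  rwa [star_star, h', inner_zero_left] at h1

theorem norm_sq_defect_apply {x : H →L[ℂ] H} (hx : star x * x = 1) (ξ : H) :
    ‖(1 - x * star x) ξ‖ ^ 2 + ‖star x ξ‖ ^ 2 = ‖ξ‖ ^ 2 := by
  have h := norm_add_sq_eq_norm_sq_add_norm_sq_of_inner_eq_zero _ _
    (inner_defect_apply_eq_zero hx ξ (star x ξ))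
  have hξ : (1 - x * star x) ξ + x (star x ξ) = ξ := sub_add_cancel ξ _
  rw [hξ, norm_apply_of_star_mul_self hx] at h
  linarith

theorem star_pow_mul_pow {x : H →L[ℂ] H} (hx : star x * x = 1) (n : ℕ) :
    star (x ^ n) * x ^ n = 1 := by
  induction n with
  | zero => simp
  | succ n ih =>
    rw [pow_succ, star_mul, mul_assoc, ← mul_assoc _ _ x, ih, one_mul, hx]

/-- Successive approximations to the diagonal part of `t` with respect to the nests
`range (x ^ n)` and `range (a ^ n)`. -/
noncomputable def diagonalApprox (a x t : H →L[ℂ] H) : ℕ → (H →L[ℂ] H)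
  | 0 => t
  | n + 1 => (1 - a * star a) * t + a * diagonalApprox a x t n * star x

variable {a x t : H →L[ℂ] H}

theorem defect_mul_mul_eq_zero (hat : a * t = t * x) (ha : star a * a = 1) :
    (1 - a * star a) * t * x = 0 := by
  rw [mul_assoc, ← hat, sub_mul, one_mul, mul_assoc a, ← mul_assoc (star a), ha, one_mul, sub_self]

theorem norm_diagonalApprox_apply_le (ha : star a * a = 1) (hx : star x * x = 1)
    (hat : a * t = t * x) (n : ℕ) (ξ : H) : ‖diagonalApprox a x t n ξ‖ ≤ ‖t‖ * ‖ξ‖ := by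
  induction n generalizing ξ with
  | zero => exact t.le_opNorm ξ
  | succ n ih =>
    set D := diagonalApprox a x t n
    have hd : (1 - a * star a) (t ξ) = (1 - a * star a) (t ((1 - x * star x) ξ)) := by
      have : (1 - a * star a) * t = (1 - a * star a) * t * (1 - x * star x) := by
        rw [mul_sub, mul_one, ← mul_assoc, defect_mul_mul_eq_zero hat ha, zero_mul, sub_zero]
      exact congrArg (· ξ) this
    have horth : inner ℂ ((1 - a * star a) (t ξ)) (a (D (star x ξ))) = 0 :=
      inner_defect_apply_eq_zero ha _ _
    have h1 := norm_add_sq_eq_norm_sq_add_norm_sq_of_inner_eq_zero _ _ horth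
    have h2 : ‖(1 - a * star a) (t ξ)‖ ≤ ‖t‖ * ‖(1 - x * star x) ξ‖ := by
      rw [hd]
      refine le_trans ?_ (t.le_opNorm _)
      have := norm_sq_defect_apply ha (t ((1 - x * star x) ξ))
      exact (sq_le_sq₀ (norm_nonneg _) (norm_nonneg _)).1 (by nlinarith)
    have h3 : ‖a (D (star x ξ))‖ ≤ ‖t‖ * ‖star x ξ‖ := by
      rw [norm_apply_of_star_mul_self ha]
      exact ih _
    have h4 := norm_sq_defect_apply hx ξ
    refine (sq_le_sq₀ (norm_nonneg _) (by positivity)).1 ?_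
    change ‖(1 - a * star a) (t ξ) + a (D (star x ξ))‖ ^ 2 ≤ _
    calc _ = ‖(1 - a * star a) (t ξ)‖ ^ 2 + ‖a (D (star x ξ))‖ ^ 2 := by
          linarith [h1]
      _ ≤ (‖t‖ * ‖(1 - x * star x) ξ‖) ^ 2 + (‖t‖ * ‖star x ξ‖) ^ 2 := by gcongr
      _ = (‖t‖ * ‖ξ‖) ^ 2 := by rw [mul_pow, mul_pow, mul_pow, ← h4]; ring

theorem diagonalApprox_mul_pow (ha : star a * a = 1) (hx : star x * x = 1)
    (hat : a * t = t * x) (n : ℕ) : diagonalApprox a x t n * x ^ n = t * x ^ n := by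
  have key : ∀ n, diagonalApprox a x t n * x ^ n = a ^ n * t := by
    intro n
    induction n with
    | zero => simp [diagonalApprox]
    | succ n ih =>
      calc _ = (1 - a * star a) * t * x * x ^ n
            + a * diagonalApprox a x t n * (star x * x) * x ^ n := by
            rw [diagonalApprox, pow_succ']; noncomm_ring
        _ = a * (diagonalApprox a x t n * x ^ n) := by
            rw [defect_mul_mul_eq_zero hat ha, hx]; noncomm_ring
        _ = _ := by rw [ih, pow_succ', mul_assoc]
  rw [key]
  exact (SemiconjBy.pow_right (show SemiconjBy t x a from hat.symm) n).eq.symm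

theorem diagonalApprox_add_sub (n j : ℕ) :
    diagonalApprox a x t (n + j) - diagonalApprox a x t n =
      a ^ n * (diagonalApprox a x t j - t) * star x ^ n := by
  induction n with
  | zero => simp [diagonalApprox]
  | succ n ih =>
    rw [Nat.add_right_comm, diagonalApprox, diagonalApprox, pow_succ' a, pow_succ (star x)]
    calc _ = a * (diagonalApprox a x t (n + j) - diagonalApprox a x t n) * star x := by
          noncomm_ring
      _ = _ := by rw [ih]; noncomm_ring

theorem cauchySeq_diagonalApprox (ha : star a * a = 1) (hx : star x * x = 1)
    (hat : a * t = t * x) (ξ : H) : CauchySeq fun n => diagonalApprox a x t n ξ := by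
  have hanti : Antitone fun n => ‖(star x ^ n) ξ‖ ^ 2 := by
    refine antitone_nat_of_succ_le fun n => ?_
    have := norm_sq_defect_apply hx ((star x ^ n) ξ)
    have h : (star x ^ (n + 1)) ξ = star x ((star x ^ n) ξ) := by rw [pow_succ']; rfl
    simp only [h]
    nlinarith
  have hlim := tendsto_atTop_ciInf hanti ⟨0, by rintro _ ⟨n, rfl⟩; positivity⟩
  rw [Metric.cauchySeq_iff']
  intro ε hε
  set C := 2 * ‖t‖ + 1
  have hC : 0 < C := by positivity
  obtain ⟨N, hN⟩ := Metric.cauchySeq_iff'.1 hlim.cauchySeq ((ε / C) ^ 2) (by positivity)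
  refine ⟨N, fun n hn => ?_⟩
  obtain ⟨j, rfl⟩ := Nat.exists_eq_add_of_le hn
  set η := (star x ^ N) ξ
  have h1 : ‖(1 - x ^ j * star (x ^ j)) η‖ < ε / C := by
    have h2 := norm_sq_defect_apply (star_pow_mul_pow hx j) η
    have h3 := hN (N + j) hn
    rw [Real.dist_eq, abs_lt, add_comm, pow_add] at h3
    have h4 : star (x ^ j) η = (star x ^ j * star x ^ N) ξ := by rw [star_pow]; rfl
    rw [h4] at h2
    refine (sq_lt_sq₀ (norm_nonneg _) (by positivity)).1 ?_
    linarith [h3.1]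
  have h2 : (diagonalApprox a x t j - t) η =
      (diagonalApprox a x t j - t) ((1 - x ^ j * star (x ^ j)) η) := by
    have : (diagonalApprox a x t j - t) * (1 - x ^ j * star (x ^ j)) =
        diagonalApprox a x t j - t := by
      rw [mul_sub, mul_one, ← mul_assoc, sub_mul _ _ (x ^ j), diagonalApprox_mul_pow ha hx hat,
        sub_self, zero_mul, sub_zero]
    exact congrArg (· η) this.symm
  rw [dist_eq_norm, ← sub_apply, diagonalApprox_add_sub]
  change ‖(a ^ N) ((diagonalApprox a x t j - t) η)‖ < ε
  rw [norm_apply_of_star_mul_self (star_pow_mul_pow ha N), h2]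
  set ζ := (1 - x ^ j * star (x ^ j)) η
  calc _ ≤ ‖diagonalApprox a x t j ζ‖ + ‖t ζ‖ := norm_sub_le _ _
    _ ≤ ‖t‖ * ‖ζ‖ + ‖t‖ * ‖ζ‖ :=
        add_le_add (norm_diagonalApprox_apply_le ha hx hat j ζ) (t.le_opNorm ζ)
    _ ≤ C * ‖ζ‖ := by simp only [C]; linarith [norm_nonneg ζ]
    _ < C * (ε / C) := by gcongr
    _ = ε := by field_simp

/-- The diagonal part of `t` exists as a strong limit. -/
theorem exists_tendsto_diagonalApprox (ha : star a * a = 1) (hx : star x * x = 1)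
    (hat : a * t = t * x) :
    ∃ D : H →L[ℂ] H, ∀ ξ, Filter.Tendsto (fun n => diagonalApprox a x t n ξ) Filter.atTop
      (nhds (D ξ)) := by
  choose f hf using fun ξ => cauchySeq_tendsto_of_complete (cauchySeq_diagonalApprox ha hx hat ξ)
  exact ⟨continuousLinearMapOfTendsto _ (tendsto_pi_nhds.2 hf), hf⟩

end Isometry

section UnitaryEquivalence

variable {H : Type*} [NormedAddCommGroup H] [InnerProductSpace ℂ H] [CompleteSpace H]
  {M : VonNeumannAlgebra H} {a x t s : H →L[ℂ] H}

open Filter Topology VonNeumannAlgebra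

theorem diagonalApprox_mem (ha : a ∈ M) (hx : x ∈ M) (ht : t ∈ M) (n : ℕ) :
    diagonalApprox a x t n ∈ M := by
  induction n with
  | zero => exact ht
  | succ n ih =>
    exact add_mem (mul_mem (sub_mem (one_mem M) (mul_mem ha (star_mem ha))) ht)
      (mul_mem (mul_mem ha ih) (star_mem hx))

theorem VonNeumannAlgebra.mem_of_tendsto {D : H →L[ℂ] H} {F : ℕ → (H →L[ℂ] H)}
    (hF : ∀ n, F n ∈ M) (hD : ∀ ξ, Tendsto (fun n => F n ξ) atTop (𝓝 (D ξ))) : D ∈ M := by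
  refine mem_iff_forall_commute.2 fun y hy => ?_
  ext ξ
  refine tendsto_nhds_unique ((y.continuous.tendsto _).comp (hD ξ)) ?_
  refine (hD (y ξ)).congr fun n => ?_
  exact (congrArg (· ξ) (commute_of_mem_commutant (hF n) hy).eq).symm

theorem diagonalApprox_mul_diagonalApprox (ha : star a * a = 1) (hx : star x * x = 1)
    (hat : a * t = t * x) (hst : s * t = 1) (hts : t * s = 1) (n : ℕ) :
    diagonalApprox x a s n * diagonalApprox a x t n = 1 := by
  have hxs : x * s = s * a := intertwine_inverse hat hst hts
  induction n with
  | zero => exact hst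
  | succ n ih =>
    have h1 : (1 - x * star x) * s * a = 0 := defect_mul_mul_eq_zero hxs hx
    have h2 : star a * (1 - a * star a) = 0 := by
      rw [mul_sub, mul_one, ← mul_assoc, ha, one_mul, sub_self]
    calc _ = (1 - x * star x) * (s * t) - (1 - x * star x) * s * a * (star a * t)
          + (1 - x * star x) * s * a * (diagonalApprox a x t n * star x)
          + x * diagonalApprox x a s n * (star a * (1 - a * star a)) * t
          + x * (diagonalApprox x a s n * (star a * a) * diagonalApprox a x t n) * star x := by
          rw [diagonalApprox, diagonalApprox]; noncomm_ring
      _ = 1 := by rw [h1, h2, hst, ha, mul_one (diagonalApprox x a s n), ih]; noncomm_ring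

/-- Similar isometries in a von Neumann algebra are similar through an operator which also
intertwines their adjoints. -/
theorem exists_invertible_intertwine_star (haM : a ∈ M) (hxM : x ∈ M) (htM : t ∈ M)
    (ha : star a * a = 1) (hx : star x * x = 1)
    (hat : a * t = t * x) (hst : s * t = 1) (hts : t * s = 1) :
    ∃ D ∈ M, ∃ E, D * E = 1 ∧ E * D = 1 ∧ a * D = D * x ∧ star a * D = D * star x := by
  have hxs : x * s = s * a := intertwine_inverse hat hst hts
  obtain ⟨D, hD⟩ := exists_tendsto_diagonalApprox ha hx hat
  obtain ⟨E, hE⟩ := exists_tendsto_diagonalApprox hx ha hxs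
  have hfix : D = (1 - a * star a) * t + a * D * star x := by
    ext ξ
    refine tendsto_nhds_unique ((tendsto_add_atTop_iff_nat 1).2 (hD ξ)) ?_
    exact ((a.continuous.tendsto _).comp (hD (star x ξ))).const_add _
  have h2 : star a * (1 - a * star a) = 0 := by
    rw [mul_sub, mul_one, ← mul_assoc, ha, one_mul, sub_self]
  refine ⟨D, mem_of_tendsto (diagonalApprox_mem haM hxM htM) hD, E,
    mul_eq_one_of_tendsto (diagonalApprox_mul_diagonalApprox hx ha hxs hts hst)
      (norm_diagonalApprox_apply_le ha hx hat) hD hE,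
    mul_eq_one_of_tendsto (diagonalApprox_mul_diagonalApprox ha hx hat hst hts)
      (norm_diagonalApprox_apply_le hx ha hxs) hE hD, ?_, ?_⟩
  · conv_rhs => rw [hfix, add_mul, defect_mul_mul_eq_zero hat ha, zero_add, mul_assoc, hx, mul_one]
  · conv_lhs => rw [hfix]
    rw [mul_add, ← mul_assoc, h2, zero_mul, zero_add, mul_assoc a, ← mul_assoc, ha, one_mul]

/-- Similar isometries in a von Neumann algebra are unitarily equivalent in it. -/
theorem exists_unitary_intertwine (haM : a ∈ M) (hxM : x ∈ M) (htM : t ∈ M)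
    (ha : star a * a = 1) (hx : star x * x = 1)
    (hat : a * t = t * x) (hst : s * t = 1) (hts : t * s = 1) :
    ∃ U ∈ M, star U * U = 1 ∧ U * star U = 1 ∧ a = U * x * star U := by
  obtain ⟨D, hDM, E, hDE, hED, haD, haD'⟩ :=
    exists_invertible_intertwine_star haM hxM htM ha hx hat hst hts
  have hEDs : star D * star E = 1 := by rw [← star_mul, hED, star_one]
  have hDEs : star E * star D = 1 := by rw [← star_mul, hDE, star_one]
  set h := CFC.abs D with hh
  have hhh : h * h = star D * D := CFC.abs_mul_abs D
  have hhs : star h = h := (CFC.abs_nonneg D).isSelfAdjoint.star_eq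
  set g := h * (E * star E) with hg
  have hhg : h * g = 1 := by
    calc h * g = h * h * (E * star E) := by rw [hg]; noncomm_ring
      _ = star D * (D * E) * star E := by rw [hhh]; noncomm_ring
      _ = 1 := by rw [hDE, mul_one, hEDs]
  have hgh : g * h = 1 := by
    have h1 : E * star E * h * h = 1 := by
      calc _ = E * star E * (h * h) := by noncomm_ring
        _ = E * (star E * star D) * D := by rw [hhh]; noncomm_ring
        _ = 1 := by rw [hDEs, mul_one, hED]
    rw [← left_inv_eq_right_inv h1 hhg]
    exact h1
  have hgM : g ∈ M := mem_of_mul_eq_one (abs_mem hDM) hhg hgh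
  have hsgh : star g * h = 1 := by
    have := congrArg star hhg
    rwa [star_mul, hhs, star_one] at this
  have hDa : star D * a = x * star D := by
    have := congrArg star haD'
    simpa using this
  have hxh : h * x = x * h := by
    have h1 : Commute (star D * D) x := by
      change star D * D * x = x * (star D * D)
      rw [mul_assoc, ← haD, ← mul_assoc, hDa, mul_assoc]
    exact (h1.cfcₙ_nnreal NNReal.sqrt).eq
  have hxg : g * x = x * g := by
    calc g * x = g * x * (h * g) := by rw [hhg, mul_one]
      _ = g * (x * h) * g := by noncomm_ring
      _ = (g * h) * x * g := by rw [← hxh]; noncomm_ring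
      _ = _ := by rw [hgh, one_mul]
  have hUU : star (D * g) * (D * g) = 1 := by
    calc _ = star g * (star D * D) * g := by rw [star_mul]; noncomm_ring
      _ = star g * h * (h * g) := by rw [← hhh]; noncomm_ring
      _ = 1 := by rw [hsgh, hhg, one_mul]
  have hUi : D * g * (h * E) = 1 := by
    calc _ = D * (g * h) * E := by noncomm_ring
      _ = 1 := by rw [hgh, mul_one, hDE]
  have hUU' : D * g * star (D * g) = 1 := by
    rw [left_inv_eq_right_inv hUU hUi, hUi]
  refine ⟨D * g, mul_mem hDM hgM, hUU, hUU', ?_⟩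
  calc a = a * (D * g * star (D * g)) := by rw [hUU', mul_one]
    _ = a * D * g * star (D * g) := by noncomm_ring
    _ = D * (x * g) * star (D * g) := by rw [haD]; noncomm_ring
    _ = _ := by rw [← hxg]; noncomm_ring

/-- The components of a proper C*-convex decomposition of an isometry are unitarily equivalent
to it. -/
theorem exists_unitary_of_cstarConvex_isometry {k : ℕ} {a t : Fin k → (H →L[ℂ] H)} (hxM : x ∈ M)
    (hx : star x * x = 1) (haM : ∀ i, a i ∈ M) (ha : ∀ i, ‖a i‖ ≤ 1) (htM : ∀ i, t i ∈ M)
    (htinv : ∀ i, ∃ s ∈ M, t i * s = 1 ∧ s * t i = 1) (ht : ∑ i, star (t i) * t i = 1)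
    (hxa : x = ∑ i, star (t i) * a i * t i) (i : Fin k) :
    ∃ U ∈ M, star U * U = 1 ∧ U * star U = 1 ∧ a i = U * x * star U := by
  obtain ⟨s, -, hts, hst⟩ := htinv i
  have key := intertwine_of_cstarConvex_isometry hx ha ht hxa i
  refine exists_unitary_intertwine (haM i) hxM (htM i) ?_ hx ?_ hst hts
  · refine star_mul_self_of_norm_apply fun ξ => ?_
    have h1 : t i (s ξ) = ξ := congrArg (· ξ) hts
    simpa only [h1] using (key (s ξ)).2
  · ext ξ
    exact (key ξ).1

end UnitaryEquivalence

theorem eq_of_mul_eq_of_one_sub_mul_eq {R : Type*} [Ring R] {z a b : R} (h : z * a = z * b)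
    (h' : (1 - z) * a = (1 - z) * b) : a = b := by
  have := congrArg₂ (· + ·) h h'
  simpa [sub_mul] using this

section CentralDecomposition

variable {H : Type*} [NormedAddCommGroup H] [InnerProductSpace ℂ H] [CompleteSpace H]
  {M : VonNeumannAlgebra H}

open VonNeumannAlgebra

namespace IsCentralProjection

variable {z : H →L[ℂ] H}

theorem mul_one_sub (hz : IsCentralProjection M z) : z * (1 - z) = 0 := by
  rw [mul_sub, mul_one, hz.2.2.1, sub_self]

theorem mul_mul_mul_congr {A A' B B' x : H →L[ℂ] H} (hz : IsCentralProjection M z)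
    (hA' : A' ∈ M) (hx : x ∈ M) (hA : z * A = z * A') (hB : z * B = z * B') :
    z * (A * x * B) = z * (A' * x * B') := by
  have hc := hz.2.2.2 (A' * x) (mul_mem hA' hx)
  calc z * (A * x * B) = z * A * x * B := by noncomm_ring
    _ = z * (A' * x) * B := by rw [hA]; noncomm_ring
    _ = A' * x * (z * B) := by rw [hc]; noncomm_ring
    _ = A' * x * z * B' := by rw [hB]; noncomm_ring
    _ = _ := by rw [← hc]; noncomm_ring

theorem star_mul_self_mul (hz : IsCentralProjection M z) {x : H →L[ℂ] H} (hx : x ∈ M) :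
    star (z * x) * (z * x) = z * (star x * x) := by
  have h1 := hz.2.2.2 (star x) (star_mem hx)
  calc _ = star x * (z * z) * x := by rw [star_mul, hz.2.1]; noncomm_ring
    _ = _ := by rw [hz.2.2.1, ← h1]; noncomm_ring

theorem mul_star_self_mul (hz : IsCentralProjection M z) {x : H →L[ℂ] H} (hx : x ∈ M) :
    z * x * star (z * x) = z * (x * star x) := by
  have h1 := hz.2.2.2 (x * star x) (mul_mem hx (star_mem hx))
  calc _ = z * (x * star x * z) := by rw [star_mul, hz.2.1]; noncomm_ring
    _ = z * z * (x * star x) := by rw [← h1]; noncomm_ring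
    _ = _ := by rw [hz.2.2.1]

theorem norm_sq_apply_add (hz : IsCentralProjection M z) (ξ η : H) :
    ‖z ξ + (1 - z) η‖ ^ 2 = ‖z ξ‖ ^ 2 + ‖(1 - z) η‖ ^ 2 := by
  have h : inner ℂ (z ξ) ((1 - z) η) = 0 := by
    have h1 := inner_star_apply_right z ξ ((1 - z) η)
    have h2 : z ((1 - z) η) = 0 := congrArg (· η) hz.mul_one_sub
    rw [hz.2.1, h2, inner_zero_right] at h1
    exact h1.symm
  have := norm_add_sq_eq_norm_sq_add_norm_sq_of_inner_eq_zero _ _ h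
  linarith

theorem norm_mul_add_le (hz : IsCentralProjection M z) {a : H →L[ℂ] H} (ha : a ∈ M)
    (ha1 : ‖a‖ ≤ 1) : ‖z * a + (1 - z)‖ ≤ 1 := by
  refine ContinuousLinearMap.opNorm_le_bound _ zero_le_one fun ξ => ?_
  rw [one_mul]
  have h1 : z (a ξ) = a (z ξ) := congrArg (· ξ) (hz.2.2.2 a ha)
  have h2 : ‖a (z ξ)‖ ≤ ‖z ξ‖ := by simpa using a.le_of_opNorm_le ha1 (z ξ)
  have h3 := hz.norm_sq_apply_add ξ ξ
  have h4 : z ξ + (1 - z) ξ = ξ := add_sub_cancel (z ξ) ξ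
  rw [h4] at h3
  have h5 := hz.norm_sq_apply_add (a ξ) ξ
  change ‖z (a ξ) + (1 - z) ξ‖ ≤ ‖ξ‖
  refine (sq_le_sq₀ (norm_nonneg _) (norm_nonneg _)).1 ?_
  rw [h5, h3, h1]
  gcongr

/-- On the central summand where `x` is an isometry, the components of a proper C*-convex
decomposition of `x` are unitarily equivalent to `x`. -/
theorem exists_unitary_of_cstarConvex (hz : IsCentralProjection M z) {k : ℕ} {x : H →L[ℂ] H}
    {a t : Fin k → (H →L[ℂ] H)} (hxM : x ∈ M) (hzx : z * (star x * x) = z)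
    (haM : ∀ i, a i ∈ M) (ha : ∀ i, ‖a i‖ ≤ 1) (htM : ∀ i, t i ∈ M)
    (htinv : ∀ i, ∃ s ∈ M, t i * s = 1 ∧ s * t i = 1) (ht : ∑ i, star (t i) * t i = 1)
    (hxa : x = ∑ i, star (t i) * a i * t i) (i : Fin k) :
    ∃ U ∈ M, star U * U = 1 ∧ U * star U = 1 ∧ z * a i = z * (U * x * star U) := by
  have hz' := hz.one_sub
  have hzmul : ∀ b : H →L[ℂ] H, z * (z * b + (1 - z)) = z * b := fun b => by
    rw [mul_add, hz.mul_one_sub, ← mul_assoc, hz.2.2.1, add_zero]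
  have hzmul' : ∀ b : H →L[ℂ] H, (1 - z) * (z * b + (1 - z)) = 1 - z := fun b => by
    rw [mul_add, ← mul_assoc, hz'.2.2.1, sub_mul, hz.2.2.1, one_mul, sub_self, zero_mul, zero_add]
  have hmem : ∀ b ∈ M, z * b + (1 - z) ∈ M := fun b hb => add_mem (mul_mem hz.1 hb) hz'.1
  have hx' : star (z * x + (1 - z)) * (z * x + (1 - z)) = 1 := by
    have hstar : star (z * x + (1 - z)) = z * star x + (1 - z) := by
      rw [star_add, star_mul, hz.2.1, hz'.2.1, hz.2.2.2 _ (star_mem hxM)]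
    rw [hstar]
    apply eq_of_mul_eq_of_one_sub_mul_eq (z := z)
    · have h := hz.mul_mul_mul_congr (star_mem hxM) (one_mem M) (hzmul (star x)) (hzmul x)
      rw [mul_one, mul_one, hzx] at h
      rw [h, mul_one]
    · rw [← mul_assoc, hzmul', hzmul', mul_one]
  have hsum : z * x + (1 - z) = ∑ j, star (t j) * (z * a j + (1 - z)) * t j := by
    have h1 : ∀ j, star (t j) * (z * a j + (1 - z)) * t j =
        z * (star (t j) * a j * t j) + (1 - z) * (star (t j) * t j) := fun j => by
      have h2 := hz.2.2.2 _ (star_mem (htM j))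
      have h3 := hz'.2.2.2 _ (star_mem (htM j))
      calc _ = star (t j) * z * a j * t j + star (t j) * (1 - z) * t j := by
            rw [mul_add, add_mul]; simp only [mul_assoc]
        _ = _ := by rw [← h2, ← h3]; simp only [mul_assoc]
    rw [Finset.sum_congr rfl fun j _ => h1 j, Finset.sum_add_distrib, ← Finset.mul_sum,
      ← Finset.mul_sum, ht, mul_one, ← hxa]
  obtain ⟨U, hUM, hU, hU', haU⟩ := exists_unitary_of_cstarConvex_isometry (hmem x hxM) hx'
    (fun j => hmem _ (haM j)) (fun j => hz.norm_mul_add_le (haM j) (ha j)) htM htinv ht hsum i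
  refine ⟨U, hUM, hU, hU', ?_⟩
  have hc := hz.2.2.2 U hUM
  calc z * a i = z * (U * (z * x + (1 - z)) * star U) := by rw [← haU, hzmul]
    _ = z * U * (z * x + (1 - z)) * star U := by simp only [mul_assoc]
    _ = U * (z * (z * x + (1 - z))) * star U := by rw [hc]; simp only [mul_assoc]
    _ = U * z * x * star U := by rw [hzmul]; simp only [mul_assoc]
    _ = _ := by rw [← hc]; simp only [mul_assoc]

/-- The direct sum of an isometry and a coisometry is a C*-extreme point of the unit ball. -/
theorem isCStarExtremePoint (hz : IsCentralProjection M z) {x : H →L[ℂ] H} (hxM : x ∈ M)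
    (hx : ‖x‖ ≤ 1) (hzx : z * (star x * x) = z) (hzx' : (1 - z) * (x * star x) = 1 - z) :
    IsCStarExtremePoint M x := by
  refine ⟨hxM, hx, fun k a t haM ha htM htinv ht hxa i => ?_⟩
  have hz' := hz.one_sub
  obtain ⟨U, hUM, hU, hU', haU⟩ :=
    hz.exists_unitary_of_cstarConvex hxM hzx haM ha htM htinv ht hxa i
  obtain ⟨V, hVM, hV, hV', haV⟩ := hz'.exists_unitary_of_cstarConvex (a := fun j => star (a j))
    (star_mem hxM) (by rwa [star_star]) (fun j => star_mem (haM j))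
    (fun j => by rw [norm_star]; exact ha j) htM htinv ht
    (by rw [hxa, star_sum]; simp only [star_mul, star_star, mul_assoc]) i
  have haV' : (1 - z) * a i = (1 - z) * (V * x * star V) := by
    have h1 := congrArg star haV
    simp only [star_mul, star_star, hz'.2.1] at h1
    rw [hz'.2.2.2 _ (haM i), h1, ← hz'.2.2.2 _ (mul_mem hVM (mul_mem hxM (star_mem hVM))), mul_assoc V]
  set W := z * U + (1 - z) * V with hWdef
  have hWM : W ∈ M := add_mem (mul_mem hz.1 hUM) (mul_mem hz'.1 hVM)
  have hzW : z * W = z * U := by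
    rw [hWdef, mul_add, ← mul_assoc, ← mul_assoc, hz.mul_one_sub, hz.2.2.1, zero_mul, add_zero]
  have hzW' : (1 - z) * W = (1 - z) * V := by
    rw [hWdef, mul_add, ← mul_assoc, ← mul_assoc, hz'.2.2.1, sub_mul 1 z z, hz.2.2.1, one_mul,
      sub_self, zero_mul, zero_add]
  have hstar : ∀ {p : H →L[ℂ] H}, IsCentralProjection M p → ∀ {A B : H →L[ℂ] H}, A ∈ M → B ∈ M →
      p * A = p * B → p * star A = p * star B := by
    intro p hp A B hA hB h
    have h1 := congrArg star h
    rwa [star_mul, star_mul, hp.2.1, ← hp.2.2.2 _ (star_mem hA),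
      ← hp.2.2.2 _ (star_mem hB)] at h1
  have hsW := hstar hz hWM hUM hzW
  have hsW' := hstar hz' hWM hVM hzW'
  refine ⟨star W, star_mem hWM, ?_, ?_, ?_⟩ <;> rw [star_star]
  · apply eq_of_mul_eq_of_one_sub_mul_eq (z := z)
    · simpa [hU'] using hz.mul_mul_mul_congr hUM (one_mem M) hzW hsW
    · simpa [hV'] using hz'.mul_mul_mul_congr hVM (one_mem M) hzW' hsW'
  · apply eq_of_mul_eq_of_one_sub_mul_eq (z := z)
    · simpa [hU] using hz.mul_mul_mul_congr (star_mem hUM) (one_mem M) hsW hzW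
    · simpa [hV] using hz'.mul_mul_mul_congr (star_mem hVM) (one_mem M) hsW' hzW'
  · apply eq_of_mul_eq_of_one_sub_mul_eq (z := z)
    · rw [haU, hz.mul_mul_mul_congr hUM hxM hzW hsW]
    · rw [haV', hz'.mul_mul_mul_congr hVM hxM hzW' hsW']

end IsCentralProjection

end CentralDecomposition

/-- Theorem A: a contraction `x` in a von Neumann algebra `M` is a C*-extreme point
of the closed unit ball of `M` iff there are central projections `p₁, p₂, p₃` with
`p₁ + p₂ + p₃ = 1` such that `p₁ x` is a unitary in `p₁ M` (or `p₁ = 0`), `p₂ x` is a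
non-unitary isometry in `p₂ M` (or `p₂ = 0`), and `p₃ x` is a non-unitary coisometry
in `p₃ M` (or `p₃ = 0`). -/
theorem cstarExtreme_iff_central_decomposition {H : Type*} [NormedAddCommGroup H]
    [InnerProductSpace ℂ H] [CompleteSpace H] (M : VonNeumannAlgebra H)
    (x : H →L[ℂ] H) (hxM : x ∈ M) (hx : ‖x‖ ≤ 1) :
    IsCStarExtremePoint M x ↔
      ∃ p₁ p₂ p₃ : H →L[ℂ] H,
        IsCentralProjection M p₁ ∧ IsCentralProjection M p₂ ∧ IsCentralProjection M p₃ ∧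
        p₁ + p₂ + p₃ = 1 ∧
        (p₁ = 0 ∨ (star (p₁ * x) * (p₁ * x) = p₁ ∧ (p₁ * x) * star (p₁ * x) = p₁)) ∧
        (p₂ = 0 ∨ (star (p₂ * x) * (p₂ * x) = p₂ ∧ (p₂ * x) * star (p₂ * x) ≠ p₂)) ∧
        (p₃ = 0 ∨ ((p₃ * x) * star (p₃ * x) = p₃ ∧ star (p₃ * x) * (p₃ * x) ≠ p₃)) := by
  constructor
  · intro h
    obtain ⟨z, hz, hiso, hco⟩ := h.exists_isCentralProjection
    have hz' := hz.one_sub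
    have h0 : IsCentralProjection M 0 := ⟨zero_mem M, star_zero _, mul_zero _, by simp⟩
    have h1 : IsCentralProjection M 1 := ⟨one_mem M, star_one _, mul_one _, by simp⟩
    have hsm := hz.star_mul_self_mul hxM
    have hms := hz.mul_star_self_mul hxM
    have hsm' := hz'.star_mul_self_mul hxM
    have hms' := hz'.mul_star_self_mul hxM
    by_cases hu : z * (x * star x) = z <;> by_cases hu' : (1 - z) * (star x * x) = 1 - z
    · refine ⟨1, 0, 0, h1, h0, h0, by simp, Or.inr ⟨?_, ?_⟩, Or.inl rfl, Or.inl rfl⟩ <;>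
        rw [one_mul] <;> apply eq_of_mul_eq_of_one_sub_mul_eq (z := z) <;>
        simp only [mul_one, hiso, hco, hu, hu']
    · exact ⟨z, 0, 1 - z, hz, h0, hz', by simp, Or.inr ⟨hsm.trans hiso, hms.trans hu⟩, Or.inl rfl,
        Or.inr ⟨hms'.trans hco, fun e => hu' (hsm'.symm.trans e)⟩⟩
    · exact ⟨1 - z, z, 0, hz', hz, h0, by simp, Or.inr ⟨hsm'.trans hu', hms'.trans hco⟩,
        Or.inr ⟨hsm.trans hiso, fun e => hu (hms.symm.trans e)⟩, Or.inl rfl⟩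
    · exact ⟨0, z, 1 - z, h0, hz, hz', by simp, Or.inl rfl,
        Or.inr ⟨hsm.trans hiso, fun e => hu (hms.symm.trans e)⟩,
        Or.inr ⟨hms'.trans hco, fun e => hu' (hsm'.symm.trans e)⟩⟩
  · rintro ⟨p₁, p₂, p₃, hp₁, hp₂, hp₃, hsum, h₁, h₂, h₃⟩
    have hp₃' : 1 - p₃ = p₁ + p₂ := by rw [← hsum]; abel
    have e₁ : p₁ * (star x * x) = p₁ := by
      rcases h₁ with rfl | h₁
      · rw [zero_mul]
      · rw [← hp₁.star_mul_self_mul hxM, h₁.1]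
    have e₂ : p₂ * (star x * x) = p₂ := by
      rcases h₂ with rfl | h₂
      · rw [zero_mul]
      · rw [← hp₂.star_mul_self_mul hxM, h₂.1]
    have e₃ : p₃ * (x * star x) = p₃ := by
      rcases h₃ with rfl | h₃
      · rw [zero_mul]
      · rw [← hp₃.mul_star_self_mul hxM, h₃.1]
    refine hp₃.one_sub.isCStarExtremePoint hxM hx ?_ ?_
    · rw [hp₃', add_mul, e₁, e₂]
    · rw [sub_sub_cancel, e₃]
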